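/- Every down-set T in the grid {0,1,2,3}³ that contains no 'bad 3-matching' has size at most 32, where a bad 3-matching is a triple a, b, c ∈ T such that in every coordinate j the three values a_j, b_j, c_j are pairwise distinct, and in at least one coordinate the fourth (unused) value of {0,1,2,3} is 0 or 1. -/

import Mathlib

/-- A down-set in the grid `{0,1,2,3}³`. -/
def IsDownSet3 (T : Finset (Fin 4 × Fin 4 × Fin 4)) : Prop :=
  ∀ p ∈ T, ∀ q : Fin 4 × Fin 4 × Fin 4,
    q.1 ≤ p.1 → q.2.1 ≤ p.2.1 → q.2.2 ≤ p.2.2 → q ∈ T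

/-- A bad `3`-matching: three points with pairwise distinct values in every coordinate such that
in at least one coordinate the unused fourth value is `0` or `1`. -/
def BadTriple (a b c : Fin 4 × Fin 4 × Fin 4) : Prop :=
  (a.1 ≠ b.1 ∧ a.1 ≠ c.1 ∧ b.1 ≠ c.1) ∧
  (a.2.1 ≠ b.2.1 ∧ a.2.1 ≠ c.2.1 ∧ b.2.1 ≠ c.2.1) ∧
  (a.2.2 ≠ b.2.2 ∧ a.2.2 ≠ c.2.2 ∧ b.2.2 ≠ c.2.2) ∧
  ((0 ∉ ({a.1, b.1, c.1} : Finset (Fin 4)) ∨ 1 ∉ ({a.1, b.1, c.1} : Finset (Fin 4))) ∨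
   (0 ∉ ({a.2.1, b.2.1, c.2.1} : Finset (Fin 4)) ∨
      1 ∉ ({a.2.1, b.2.1, c.2.1} : Finset (Fin 4))) ∨
   (0 ∉ ({a.2.2, b.2.2, c.2.2} : Finset (Fin 4)) ∨
      1 ∉ ({a.2.2, b.2.2, c.2.2} : Finset (Fin 4))))

/-- Points of the grid. -/
abbrev GridPt := Fin 4 × Fin 4 × Fin 4

/-- Coordinatewise comparison. -/
def gle (q p : GridPt) : Bool :=
  decide (q.1 ≤ p.1) && decide (q.2.1 ≤ p.2.1) && decide (q.2.2 ≤ p.2.2)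

instance (a b c : GridPt) : Decidable (BadTriple a b c) := by
  unfold BadTriple; infer_instance

/-- Case-distinction certificates: branch on membership of a point, or close a case by exhibiting a
bad triple, or by the excluded points leaving at most `32` others. -/
inductive Cert where
  | br (p : GridPt) (l r : Cert)
  | bad (a b c : GridPt)
  | small

/-- Validity of a certificate, given points `I` known to be in and `O` known to be out. -/
def Cert.check : Cert → List GridPt → List GridPt → Bool
  | .br p l r, I, O => l.check (p :: I) O && r.check I (p :: O)
  | .bad a b c, I, _ =>
      I.any (gle a) && I.any (gle b) && I.any (gle c) && decide (BadTriple a b c)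
  | .small, _, O =>
      decide ((Finset.univ.filter fun q : GridPt => O.all fun o => !gle o q).card ≤ 32)

theorem mem_of_any {T : Finset GridPt} (hdown : IsDownSet3 T) {I : List GridPt}
    (hI : ∀ p ∈ I, p ∈ T) {a : GridPt} (h : I.any (gle a) = true) : a ∈ T := by
  obtain ⟨p, hp, hle⟩ := List.any_eq_true.1 h
  simp only [gle, Bool.and_eq_true, decide_eq_true_eq] at hle
  exact hdown p (hI p hp) a hle.1.1 hle.1.2 hle.2

theorem Cert.sound {T : Finset GridPt} (hdown : IsDownSet3 T)
    (hbad : ¬ ∃ a ∈ T, ∃ b ∈ T, ∃ c ∈ T, BadTriple a b c) (t : Cert) :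
    ∀ I O : List GridPt, t.check I O = true → (∀ p ∈ I, p ∈ T) → (∀ p ∈ O, p ∉ T) →
      T.card ≤ 32 := by
  induction t with
  | br p l r ihl ihr =>
    intro I O h hI hO
    simp only [Cert.check, Bool.and_eq_true] at h
    by_cases hp : p ∈ T
    · exact ihl _ _ h.1 (List.forall_mem_cons.2 ⟨hp, hI⟩) hO
    · exact ihr _ _ h.2 hI (List.forall_mem_cons.2 ⟨hp, hO⟩)
  | bad a b c =>
    intro I O h hI _
    simp only [Cert.check, Bool.and_eq_true, decide_eq_true_eq] at h
    exact absurd ⟨a, mem_of_any hdown hI h.1.1.1, b, mem_of_any hdown hI h.1.1.2, c,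
      mem_of_any hdown hI h.1.2, h.2⟩ hbad
  | small =>
    intro I O h _ hO
    simp only [Cert.check, decide_eq_true_eq] at h
    refine le_trans (Finset.card_le_card fun q hq => ?_) h
    simp only [Finset.mem_filter, Finset.mem_univ, true_and, List.all_eq_true]
    intro o ho
    by_contra hle
    simp only [Bool.not_eq_true', Bool.not_eq_false, gle, Bool.and_eq_true,
      decide_eq_true_eq] at hle
    exact hO o ho (hdown q hq o hle.1.1 hle.1.2 hle.2)

/-- The certificate. -/
def theCert : Cert :=
  .br (0, 0, 2)
   (.br (0, 1, 1)
    (.br (0, 2, 0)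
     (.br (1, 0, 1)
      (.br (1, 1, 0)
       (.br (2, 0, 0)
        (.br (2, 3, 1)
         (.bad (0, 0, 2) (1, 3, 1) (2, 2, 0))
        (.br (3, 1, 2)
         (.bad (0, 2, 0) (2, 1, 2) (3, 0, 1))
        (.br (3, 2, 1)
         (.bad (0, 0, 2) (2, 2, 1) (3, 1, 0))
        (.br (0, 0, 3)
         (.br (0, 2, 3)
          (.br (1, 1, 2)
           (.bad (0, 2, 3) (1, 1, 2) (2, 0, 0))
          (.br (2, 0, 2)
           (.bad (0, 2, 3) (1, 1, 0) (2, 0, 2))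
          (.br (1, 2, 0)
           (.br (2, 1, 0)
            (.br (1, 0, 2)
             (.bad (0, 2, 3) (1, 0, 2) (2, 1, 0))
            (.br (2, 0, 1)
             (.br (0, 3, 2)
              (.bad (0, 3, 2) (1, 2, 0) (2, 0, 1))
             (.br (1, 3, 0)
              (.bad (0, 2, 2) (1, 3, 0) (2, 0, 1))
             .small))
            .small))
           .small)
          .small)))
         (.br (2, 2, 0)
          (.br (0, 3, 2)
           (.bad (0, 3, 2) (1, 0, 1) (2, 2, 0))
          (.br (1, 1, 2)
           (.bad (0, 0, 3) (1, 1, 2) (2, 2, 0))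
          (.br (1, 3, 1)
           (.bad (0, 0, 2) (1, 3, 1) (2, 2, 0))
          (.br (3, 0, 2)
           (.bad (0, 1, 1) (2, 2, 0) (3, 0, 2))
          (.br (3, 1, 1)
           (.bad (0, 0, 2) (2, 2, 0) (3, 1, 1))
          (.br (1, 0, 2)
           (.br (0, 1, 3)
            (.bad (0, 1, 3) (1, 0, 2) (2, 2, 0))
           (.br (0, 3, 1)
            (.bad (0, 3, 1) (1, 0, 2) (2, 2, 0))
           (.br (0, 1, 2)
            (.br (1, 0, 3)
             (.bad (0, 1, 2) (1, 0, 3) (2, 2, 0))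
            .small)
           .small)))
          .small))))))
         (.br (2, 0, 1)
          (.br (0, 2, 2)
           (.br (1, 1, 3)
            (.bad (0, 2, 2) (1, 1, 3) (2, 0, 0))
           (.br (1, 3, 0)
            (.bad (0, 2, 2) (1, 3, 0) (2, 0, 1))
           (.br (2, 0, 2)
            (.br (2, 0, 3)
             (.bad (0, 2, 2) (1, 1, 0) (2, 0, 3))
            (.br (1, 2, 0)
             (.br (0, 1, 3)
              (.bad (0, 1, 3) (1, 2, 0) (2, 0, 2))
             (.br (0, 3, 1)
              (.bad (0, 3, 1) (1, 2, 0) (2, 0, 2))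
             .small))
            .small))
           .small)))
          (.br (2, 0, 2)
           (.br (1, 1, 3)
            (.bad (0, 2, 0) (1, 1, 3) (2, 0, 2))
           (.br (0, 3, 0)
            (.br (1, 2, 0)
             (.br (0, 1, 3)
              (.bad (0, 1, 3) (1, 2, 0) (2, 0, 2))
             (.br (0, 3, 1)
              (.bad (0, 3, 1) (1, 2, 0) (2, 0, 2))
             (.br (1, 2, 1)
              (.bad (0, 3, 0) (1, 2, 1) (2, 0, 2))
             .small)))
            .small)
           .small))
          .small))
         .small)))
        (.br (0, 2, 1)
         (.br (1, 2, 0)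
          (.br (2, 0, 1)
           (.br (0, 3, 2)
            (.bad (0, 3, 2) (1, 2, 0) (2, 0, 1))
           (.br (1, 0, 2)
            (.br (2, 3, 0)
             (.bad (0, 2, 1) (1, 0, 2) (2, 3, 0))
            (.br (2, 1, 1)
             (.br (3, 0, 0)
              (.br (0, 2, 2)
               (.bad (0, 2, 2) (2, 1, 1) (3, 0, 0))
              (.br (0, 3, 1)
               (.br (2, 0, 2)
                (.bad (0, 3, 1) (1, 2, 0) (2, 0, 2))
               .small)
              .small))
             .small)
            .small))
           .small))
          .small)
         .small)
        .small)))))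
       .small)
      .small)
     .small)
    .small)
   .small)
  .small

theorem theCert_check : theCert.check [] [] = true := by
  decide +kernel

/-- Every down-set in `{0,1,2,3}³` containing no bad `3`-matching has size at most `32`. -/
theorem stmt12 (T : Finset (Fin 4 × Fin 4 × Fin 4)) (hdown : IsDownSet3 T)
    (hbad : ¬ ∃ a ∈ T, ∃ b ∈ T, ∃ c ∈ T, BadTriple a b c) :
    T.card ≤ 32 := by
  exact theCert.sound hdown hbad [] [] theCert_check (by simp) (by simp)
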